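/- Let 0 < ε < 1 and let 𝒮 be a martingale ε-sparse family of subintervals of [0,1). Let K ∈ 𝐊 and set J := K^m. Define 𝒮¹_K := {I ∈ 𝒮 : I ⊆ K, I ∩ I(J) = ∅, and I is not contained in any member of ch_𝐊(K)}, 𝒮²_K := {I ∈ 𝒮 : I ⊆ K, I intersects I(J) but does not intersect J}, and 𝒮³_K := {I ∈ 𝒮 : I ⊆ K, I intersects both J and I(J), and |I| ≥ 2|I(J)|}. There exists a constant C(p) > 0, depending only on p and independent of k, ε, 𝒮, K, and the choices of the intervals I(J), such that for m = 1, 2, 3: Σ_{I ∈ 𝒮^m_K} ⟨w_k⟩_I^p·⟨σ_k⟩_I·|I| ≤ C(p)·k·3^{−k}·w_k(K)/(1−ε) and Σ_{I ∈ 𝒮^m_K} ⟨σ_k⟩_I^{p'}·⟨w_k⟩_I·|I| ≤ C(p)·k·σ_k(K)/(1−ε), where p' := p/(p−1). -/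

import Mathlib

open MeasureTheory Set Filter

noncomputable section

namespace RTpaper

/-- The half-open interval `[a, b)` represented by the pair `(a, b)`. -/
def ivSet (I : ℝ × ℝ) : Set ℝ := Set.Ico I.1 I.2

/-- The length of the interval represented by `I`. -/
def len (I : ℝ × ℝ) : ℝ := I.2 - I.1

/-- The middle triadic child of an interval. -/
def mid (I : ℝ × ℝ) : ℝ × ℝ := (I.1 + (I.2 - I.1) / 3, I.2 - (I.2 - I.1) / 3)

/-- The families `𝐊ᵢ` of the Reguera–Thiele construction. -/
def Kfam (k : ℕ) : ℕ → Set (ℝ × ℝ)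
  | 0 => {((0 : ℝ), (1 : ℝ))}
  | (i + 1) =>
      {I | ∃ K ∈ Kfam k i, ∃ j : ℕ, j < 3 ^ (k - 1) ∧
        I = ((mid K).1 + (j : ℝ) * ((3 : ℝ) ^ (1 - (k : ℤ)) * len (mid K)),
             (mid K).1 + ((j : ℝ) + 1) * ((3 : ℝ) ^ (1 - (k : ℤ)) * len (mid K)))}

/-- The families `𝐉ᵢ` (of interest for `i ≥ 1`). -/
def Jfam (k i : ℕ) : Set (ℝ × ℝ) := {J | ∃ K ∈ Kfam k (i - 1), J = mid K}

/-- The family `𝐊 = ⋃ᵢ 𝐊ᵢ`. -/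
def KK (k : ℕ) : Set (ℝ × ℝ) := ⋃ i, Kfam k i

/-- The family `𝐉 = ⋃_{i ≥ 1} 𝐉ᵢ`. -/
def JJ (k : ℕ) : Set (ℝ × ℝ) := ⋃ i, Jfam k (i + 1)

/-- The chosen triadic interval `I(J)` adjacent to `J` of length `3^{1-k}|J|`, encoded by a
choice function `ch` deciding, for each `J`, whether `I(J)` lies to the right (`true`) or to
the left (`false`) of `J`. -/
def IJ (k : ℕ) (ch : ℝ × ℝ → Bool) (J : ℝ × ℝ) : ℝ × ℝ :=
  if ch J then (J.2, J.2 + (3 : ℝ) ^ (1 - (k : ℤ)) * len J)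
  else (J.1 - (3 : ℝ) ^ (1 - (k : ℤ)) * len J, J.1)

/-- The weight `w_k = Σ_{i ≥ 1} Σ_{J ∈ 𝐉ᵢ} (3^k/(3^{k-1}+1))^i · 1_{I(J)}`. -/
def wgt (k : ℕ) (ch : ℝ × ℝ → Bool) (x : ℝ) : ℝ :=
  ∑' i : ℕ, ∑' J : ↥(Jfam k (i + 1)),
    Set.indicator (ivSet (IJ k ch (J : ℝ × ℝ)))
      (fun _ => ((3 : ℝ) ^ k / ((3 : ℝ) ^ (k - 1) + 1)) ^ (i + 1)) x

/-- The weight `σ_k = w_k^{1-p}` on `{w_k > 0}`, and `0` elsewhere. -/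
def sgm (p : ℝ) (k : ℕ) (ch : ℝ × ℝ → Bool) (x : ℝ) : ℝ :=
  if 0 < wgt k ch x then wgt k ch x ^ (1 - p) else 0

/-- `u(I) = ∫_I u`. -/
def mass (u : ℝ → ℝ) (I : ℝ × ℝ) : ℝ := ∫ x in ivSet I, u x

/-- `⟨u⟩_I = u(I)/|I|`. -/
def avg (u : ℝ → ℝ) (I : ℝ × ℝ) : ℝ := mass u I / len I

/-- `ch_𝐊(K)`: the members of `𝐊_{i+1}` contained in `K ∈ 𝐊ᵢ`. -/
def chK (k : ℕ) (K : ℝ × ℝ) : Set (ℝ × ℝ) :=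
  {K' | ∃ i, K ∈ Kfam k i ∧ K' ∈ Kfam k (i + 1) ∧ ivSet K' ⊆ ivSet K}

/-- Triadic intervals of `ℝ`. -/
def IsTriadic (I : ℝ × ℝ) : Prop :=
  ∃ n j : ℤ, I.1 = (j : ℝ) * (3 : ℝ) ^ (-n) ∧ I.2 = ((j : ℝ) + 1) * (3 : ℝ) ^ (-n)

/-- Maximal members of `S` strictly contained in `R`. -/
def maxIn (S : Set (ℝ × ℝ)) (R : ℝ × ℝ) : Set (ℝ × ℝ) :=
  {Q | Q ∈ S ∧ ivSet Q ⊂ ivSet R ∧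
    ∀ Q' ∈ S, ivSet Q ⊆ ivSet Q' → ivSet Q' ⊂ ivSet R → ivSet Q' = ivSet Q}

/-- Martingale `ε`-sparse families of (half-open) intervals. -/
def MSparse (ε : ℝ) (S : Set (ℝ × ℝ)) : Prop :=
  S.Countable ∧ (∀ I ∈ S, I.1 < I.2) ∧
    (∀ I ∈ S, ∀ J ∈ S, ivSet I ⊆ ivSet J ∨ ivSet J ⊆ ivSet I ∨ ivSet I ∩ ivSet J = ∅) ∧
    ∀ R ∈ S, (∑' Q : ↥(maxIn S R), len (Q : ℝ × ℝ)) ≤ ε * len R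

/-- `Σ_{I ∈ F} ⟨u⟩_I^q · ⟨v⟩_I · |I|`. -/
def sumTest (q : ℝ) (u v : ℝ → ℝ) (F : Set (ℝ × ℝ)) : ℝ :=
  ∑' I : ↥F, avg u (I : ℝ × ℝ) ^ q * avg v (I : ℝ × ℝ) * len (I : ℝ × ℝ)


/-- `3^{-k}`. -/
def rr (k : ℕ) : ℝ := ((3 : ℝ) ^ k)⁻¹

/-- The `j`-th child of `K`. -/
def child (k : ℕ) (K : ℝ × ℝ) (j : ℕ) : ℝ × ℝ :=
  ((mid K).1 + (j : ℝ) * ((3 : ℝ) ^ (1 - (k : ℤ)) * len (mid K)),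
    (mid K).1 + ((j : ℝ) + 1) * ((3 : ℝ) ^ (1 - (k : ℤ)) * len (mid K)))

/-- The union of the `I(J)` of generation `n+1`. -/
def GG (k : ℕ) (ch : ℝ × ℝ → Bool) (n : ℕ) : Set ℝ :=
  {x | ∃ K ∈ Kfam k n, x ∈ ivSet (IJ k ch (mid K))}

lemma q_eq (k : ℕ) : (3 : ℝ) ^ (1 - (k : ℤ)) = 3 * rr k := by
  rw [zpow_sub₀ (by norm_num), rr]; simp [div_eq_mul_inv]

lemma rr_pos (k : ℕ) : 0 < rr k := by unfold rr; positivity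

lemma rr_le {k : ℕ} (hk : 3000 < k) : rr k ≤ 1 / 27 := by
  unfold rr
  have : (3 : ℝ) ^ 3 ≤ 3 ^ k := pow_le_pow_right₀ (by norm_num) (by omega)
  rw [one_div]
  apply inv_anti₀ (by norm_num)
  linarith

lemma pow_rr (k : ℕ) : (3 : ℝ) ^ k * rr k = 1 := by
  unfold rr; field_simp

lemma n3 {k : ℕ} (hk : 3000 < k) : (3 : ℝ) ^ (k - 1) * (3 * rr k) = 1 := by
  rw [← pow_rr k]
  obtain ⟨m, rfl⟩ : ∃ m, k = m + 1 := ⟨k - 1, by omega⟩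
  simp [pow_succ]; ring

lemma len_mid (K : ℝ × ℝ) : len (mid K) = len K / 3 := by
  simp only [len, mid]; ring

lemma child_fst (k : ℕ) (K : ℝ × ℝ) (j : ℕ) :
    (child k K j).1 = (mid K).1 + j * (rr k * len K) := by
  simp only [child, q_eq, len_mid]; ring

lemma child_snd (k : ℕ) (K : ℝ × ℝ) (j : ℕ) :
    (child k K j).2 = (mid K).1 + (j + 1) * (rr k * len K) := by
  simp only [child, q_eq, len_mid]; ring

lemma len_child (k : ℕ) (K : ℝ × ℝ) (j : ℕ) : len (child k K j) = rr k * len K := by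
  rw [len, child_fst, child_snd]; ring

lemma mem_succ {k i : ℕ} {I : ℝ × ℝ} :
    I ∈ Kfam k (i + 1) ↔ ∃ K ∈ Kfam k i, ∃ j : ℕ, j < 3 ^ (k - 1) ∧ I = child k K j := by
  rfl

lemma len_pos {k i : ℕ} {K : ℝ × ℝ} (h : K ∈ Kfam k i) : 0 < len K := by
  induction i generalizing K with
  | zero => 
    simp only [Kfam, mem_singleton_iff] at h
    subst h; norm_num [len]
  | succ i ih =>
    obtain ⟨K', h', j, -, rfl⟩ := mem_succ.1 h
    rw [len_child]
    exact mul_pos (rr_pos k) (ih h')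

lemma mem_iv {I : ℝ × ℝ} {x : ℝ} : x ∈ ivSet I ↔ I.1 ≤ x ∧ x < I.2 := Iff.rfl

lemma snd_eq (K : ℝ × ℝ) : K.2 = K.1 + len K := by simp [len]

lemma mid_fst (K : ℝ × ℝ) : (mid K).1 = K.1 + len K / 3 := by simp [mid, len]
lemma mid_snd (K : ℝ × ℝ) : (mid K).2 = K.1 + 2 * len K / 3 := by simp only [mid, len]; ring

lemma child_sub_mid {k : ℕ} (hk : 3000 < k) {K : ℝ × ℝ} (hK : 0 < len K) {j : ℕ}
    (hj : j < 3 ^ (k - 1)) : ivSet (child k K j) ⊆ ivSet (mid K) := by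
  intro x hx
  rw [mem_iv, child_fst, child_snd] at hx
  rw [mem_iv, mid_snd]
  have hr := mul_pos (rr_pos k) hK
  have h1 : (j : ℝ) + 1 ≤ 3 ^ (k - 1) := by exact_mod_cast hj
  have h2 := n3 hk
  have h3 : ((j : ℝ) + 1) * (rr k * len K) ≤ 3 ^ (k - 1) * (rr k * len K) := by gcongr
  have h4 : (3 : ℝ) ^ (k - 1) * (rr k * len K) = len K / 3 := by linear_combination len K / 3 * h2
  have h5 : 0 ≤ (j : ℝ) * (rr k * len K) := by positivity
  rw [mid_fst] at *
  constructor <;> linarith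

lemma exists_child {k : ℕ} (hk : 3000 < k) {K : ℝ × ℝ} (hK : 0 < len K) {x : ℝ}
    (hx : x ∈ ivSet (mid K)) : ∃ j < 3 ^ (k - 1), x ∈ ivSet (child k K j) := by
  have hr := mul_pos (rr_pos k) hK
  rw [mem_iv, mid_snd] at hx
  have h2 := n3 hk
  have h4 : (3 : ℝ) ^ (k - 1) * (rr k * len K) = len K / 3 := by linear_combination len K / 3 * h2
  set y := (x - (mid K).1) / (rr k * len K) with hy
  have hy0 : 0 ≤ y := div_nonneg (by linarith) hr.le
  have hyx : x = (mid K).1 + y * (rr k * len K) := by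
    rw [hy, div_mul_cancel₀ _ hr.ne']; ring
  have a1 := Nat.floor_le hy0
  have a2 := Nat.lt_floor_add_one y
  refine ⟨⌊y⌋₊, ?_, ?_⟩
  · rw [Nat.floor_lt hy0, hy, div_lt_iff₀ hr]
    push_cast
    rw [h4]
    rw [mid_fst] at *
    linarith
  · rw [mem_iv, child_fst, child_snd, hyx]
    constructor
    · gcongr
    · gcongr

lemma child_disj {k : ℕ} {K : ℝ × ℝ} (hK : 0 < len K) {i j : ℕ} {x : ℝ}
    (hi : x ∈ ivSet (child k K i)) (hj : x ∈ ivSet (child k K j)) : i = j := by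
  have hr := mul_pos (rr_pos k) hK
  rw [mem_iv, child_fst, child_snd] at hi hj
  have h1 : (i : ℝ) * (rr k * len K) < (j + 1) * (rr k * len K) := by linarith
  have h2 : (j : ℝ) * (rr k * len K) < (i + 1) * (rr k * len K) := by linarith
  have h3 := lt_of_mul_lt_mul_right h1 hr.le
  have h4 := lt_of_mul_lt_mul_right h2 hr.le
  have h5 : i < j + 1 := by exact_mod_cast h3
  have h6 : j < i + 1 := by exact_mod_cast h4
  omega

lemma mid_sub {K : ℝ × ℝ} (hK : 0 < len K) : ivSet (mid K) ⊆ ivSet K := by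
  intro x hx
  rw [mem_iv, mid_fst, mid_snd] at hx
  rw [mem_iv, snd_eq]
  constructor <;> linarith

lemma IJ_cases (k : ℕ) (ch : ℝ × ℝ → Bool) (K : ℝ × ℝ) :
    IJ k ch (mid K) = ((mid K).2, (mid K).2 + rr k * len K) ∨
    IJ k ch (mid K) = ((mid K).1 - rr k * len K, (mid K).1) := by
  unfold IJ
  rw [q_eq, len_mid]
  split_ifs
  · left; congr 2; ring
  · right; congr 2; ring

lemma len_IJ (k : ℕ) (ch : ℝ × ℝ → Bool) (K : ℝ × ℝ) : len (IJ k ch (mid K)) = rr k * len K := by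
  rcases IJ_cases k ch K with h | h <;> rw [h, len] <;> simp

lemma IJ_mid {k : ℕ} {ch : ℝ × ℝ → Bool} {K : ℝ × ℝ} {x : ℝ}
    (h1 : x ∈ ivSet (IJ k ch (mid K))) (h2 : x ∈ ivSet (mid K)) : False := by
  rw [mem_iv] at h1 h2
  rcases IJ_cases k ch K with h | h <;> rw [h] at h1 <;> simp at h1 <;> linarith

/-- The support sits well inside. -/
lemma IJ_in {k : ℕ} (hk : 3000 < k) {ch : ℝ × ℝ → Bool} {K : ℝ × ℝ} (hK : 0 < len K) {x : ℝ}
    (h1 : x ∈ ivSet (IJ k ch (mid K))) : K.1 + len K / 4 ≤ x ∧ x ≤ K.2 - len K / 4 := by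
  rw [mem_iv] at h1
  have := mul_le_mul_of_nonneg_right (rr_le hk) hK.le
  rw [snd_eq]
  rcases IJ_cases k ch K with h | h <;> rw [h] at h1 <;> simp only [mid_fst, mid_snd] at h1 <;>
   constructor <;> linarith

lemma mid_in {K : ℝ × ℝ} (hK : 0 < len K) {x : ℝ}
    (h1 : x ∈ ivSet (mid K)) : K.1 + len K / 4 ≤ x ∧ x ≤ K.2 - len K / 4 := by
  rw [mem_iv, mid_fst, mid_snd] at h1
  rw [snd_eq]
  constructor <;> linarith

lemma IJ_sub {k : ℕ} (hk : 3000 < k) {ch : ℝ × ℝ → Bool} {K : ℝ × ℝ} (hK : 0 < len K) :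
    ivSet (IJ k ch (mid K)) ⊆ ivSet K := by
  intro x hx
  have := IJ_in hk hK hx
  rw [mem_iv]
  constructor <;> linarith

lemma K_disj {k : ℕ} (hk : 3000 < k) {i : ℕ} {K K' : ℝ × ℝ} (h : K ∈ Kfam k i)
    (h' : K' ∈ Kfam k i) {x : ℝ} (hx : x ∈ ivSet K) (hx' : x ∈ ivSet K') : K = K' := by
  induction i generalizing K K' with
  | zero => 
    simp only [Kfam, mem_singleton_iff] at h h'
    rw [h, h']
  | succ i ih =>
    obtain ⟨L, hL, j, hj, rfl⟩ := mem_succ.1 h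
    obtain ⟨L', hL', j', hj', rfl⟩ := mem_succ.1 h'
    have := ih hL hL' (mid_sub (len_pos hL) (child_sub_mid hk (len_pos hL) hj hx))
      (mid_sub (len_pos hL') (child_sub_mid hk (len_pos hL') hj' hx'))
    subst this
    rw [child_disj (len_pos hL) hx hx']

lemma K_anc {k : ℕ} (hk : 3000 < k) {i m : ℕ} {K : ℝ × ℝ} (h : K ∈ Kfam k (i + m)) :
    ∃ L ∈ Kfam k i, ivSet K ⊆ ivSet L := by
  induction m generalizing K with
  | zero => exact ⟨K, h, Subset.rfl⟩
  | succ m ih =>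
    obtain ⟨L, hL, j, hj, rfl⟩ := mem_succ.1 h
    obtain ⟨M, hM, hs⟩ := ih hL
    exact ⟨M, hM, ((child_sub_mid hk (len_pos hL) hj).trans (mid_sub (len_pos hL))).trans hs⟩

lemma G_self {k : ℕ} (hk : 3000 < k) {ch : ℝ × ℝ → Bool} {i : ℕ} {K : ℝ × ℝ} (h : K ∈ Kfam k i)
    {x : ℝ} (hx : x ∈ ivSet K) (hG : x ∈ GG k ch i) : x ∈ ivSet (IJ k ch (mid K)) := by
  obtain ⟨L, hL, hxL⟩ := hG
  rwa [K_disj hk h hL hx (IJ_sub hk (len_pos hL) hxL)]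

lemma G_gt {k : ℕ} (hk : 3000 < k) {ch : ℝ × ℝ → Bool} {i n : ℕ} (hn : i < n) {K : ℝ × ℝ}
    (h : K ∈ Kfam k i) {x : ℝ} (hx : x ∈ ivSet K) (hG : x ∈ GG k ch n) : x ∈ ivSet (mid K) := by
  obtain ⟨L, hL, hxL⟩ := hG
  obtain ⟨m, rfl⟩ : ∃ m, n = (i + 1) + m := ⟨n - (i + 1), by omega⟩
  obtain ⟨M, hM, hs⟩ := K_anc hk hL
  have hxM := hs (IJ_sub hk (len_pos hL) hxL)
  obtain ⟨L', hL', j, hj, rfl⟩ := mem_succ.1 hM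
  have hxm := child_sub_mid hk (len_pos hL') hj hxM
  rwa [K_disj hk h hL' hx (mid_sub (len_pos hL') hxm)]

lemma G_lt {k : ℕ} (hk : 3000 < k) {ch : ℝ × ℝ → Bool} {i n : ℕ} (hn : n < i) {K : ℝ × ℝ}
    (h : K ∈ Kfam k i) {x : ℝ} (hx : x ∈ ivSet K) (hG : x ∈ GG k ch n) : False := by
  obtain ⟨m, rfl⟩ : ∃ m, i = (n + 1) + m := ⟨i - (n + 1), by omega⟩
  obtain ⟨M, hM, hs⟩ := K_anc hk h
  obtain ⟨L', hL', j, hj, rfl⟩ := mem_succ.1 hM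
  have hxm := child_sub_mid hk (len_pos hL') hj (hs hx)
  exact IJ_mid (G_self hk hL' (mid_sub (len_pos hL') hxm) hG) hxm

lemma G_cases {k : ℕ} (hk : 3000 < k) {ch : ℝ × ℝ → Bool} {i n : ℕ} {K : ℝ × ℝ}
    (h : K ∈ Kfam k i) {x : ℝ} (hx : x ∈ ivSet K) (hG : x ∈ GG k ch n) :
    (n = i ∧ x ∈ ivSet (IJ k ch (mid K))) ∨ (i < n ∧ x ∈ ivSet (mid K)) := by
  rcases lt_trichotomy n i with h1 | h1 | h1
  · exact (G_lt hk h1 h hx hG).elim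
  · subst h1; exact Or.inl ⟨rfl, G_self hk h hx hG⟩
  · exact Or.inr ⟨h1, G_gt hk h1 h hx hG⟩

lemma G_disj {k : ℕ} (hk : 3000 < k) {ch : ℝ × ℝ → Bool} {m n : ℕ} {x : ℝ}
    (hm : x ∈ GG k ch m) (hn : x ∈ GG k ch n) : m = n := by
  have key : ∀ {a b : ℕ}, a < b → x ∈ GG k ch a → x ∈ GG k ch b → False := by
    intro a b hab ha hb
    obtain ⟨L, hL, hxL⟩ := hb
    exact G_lt hk hab hL (IJ_sub hk (len_pos hL) hxL) ha
  rcases lt_trichotomy m n with h1 | h1 | h1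
  · exact (key h1 hm hn).elim
  · exact h1
  · exact (key h1 hn hm).elim

lemma K_countable (k i : ℕ) : (Kfam k i).Countable := by
  induction i with
  | zero => simp [Kfam]
  | succ i ih =>
    have : Kfam k (i + 1) ⊆ ⋃ K ∈ Kfam k i, Set.range (child k K) := by
      intro I hI
      obtain ⟨L, hL, j, hj, rfl⟩ := mem_succ.1 hI
      exact mem_biUnion hL ⟨j, rfl⟩
    exact (ih.biUnion (fun _ _ => countable_range _)).mono this

lemma iv_meas (I : ℝ × ℝ) : MeasurableSet (ivSet I) := measurableSet_Ico

lemma G_meas (k : ℕ) (ch : ℝ × ℝ → Bool) (n : ℕ) : MeasurableSet (GG k ch n) := by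
  have : GG k ch n = ⋃ K ∈ Kfam k n, ivSet (IJ k ch (mid K)) := by
    ext x; simp [GG]
  rw [this]
  exact MeasurableSet.biUnion (K_countable k n) (fun _ _ => iv_meas _)

/-- Value of the weight. -/
def aa (k : ℕ) : ℝ := (3 : ℝ) ^ k / ((3 : ℝ) ^ (k - 1) + 1)

/-- General weight `c^{n+1}` on `GG n`. -/
def uu (k : ℕ) (ch : ℝ × ℝ → Bool) (c : ℝ) (x : ℝ) : ℝ :=
  ∑' n, (GG k ch n).indicator (fun _ => c ^ (n + 1)) x

lemma uu_on {k : ℕ} (hk : 3000 < k) {ch : ℝ × ℝ → Bool} {c : ℝ} {n : ℕ} {x : ℝ}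
    (h : x ∈ GG k ch n) : uu k ch c x = c ^ (n + 1) := by
  unfold uu
  rw [tsum_eq_single n, indicator_of_mem h]
  intro m hm
  exact indicator_of_notMem (fun h' => hm (G_disj hk h' h)) _

lemma uu_off {k : ℕ} {ch : ℝ × ℝ → Bool} {c : ℝ} {x : ℝ}
    (h : ∀ n, x ∉ GG k ch n) : uu k ch c x = 0 := by
  unfold uu
  simp [indicator_of_notMem (h _)]

lemma wgt_eq {k : ℕ} (hk : 3000 < k) (ch : ℝ × ℝ → Bool) : wgt k ch = uu k ch (aa k) := by
  funext x
  unfold wgt uu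
  congr 1
  funext n
  by_cases h : x ∈ GG k ch n
  · rw [indicator_of_mem h]
    obtain ⟨L, hL, hxL⟩ := h
    rw [tsum_eq_single ⟨mid L, L, hL, rfl⟩]
    · rw [indicator_of_mem hxL]; rfl
    · rintro ⟨J, L', hL', rfl⟩ hne
      apply indicator_of_notMem
      intro hx
      apply hne
      have := K_disj hk hL hL' (IJ_sub hk (len_pos hL) hxL) (IJ_sub hk (len_pos hL') hx)
      subst this; rfl
  · rw [indicator_of_notMem h]
    convert tsum_zero with J
    obtain ⟨J, L', hL', rfl⟩ := J
    apply indicator_of_notMem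
    intro hx
    exact h ⟨L', hL', hx⟩

lemma aa_pos (k : ℕ) : 0 < aa k := by unfold aa; positivity

lemma sgm_eq {p : ℝ} {k : ℕ} (hk : 3000 < k) (ch : ℝ × ℝ → Bool) :
    sgm p k ch = uu k ch (aa k ^ (1 - p)) := by
  funext x
  unfold sgm
  rw [wgt_eq hk]
  by_cases h : ∃ n, x ∈ GG k ch n
  · obtain ⟨n, hn⟩ := h
    have h0 := aa_pos k
    rw [uu_on hk hn, uu_on hk hn, if_pos (by positivity), ← Real.rpow_natCast,
      ← Real.rpow_natCast, ← Real.rpow_mul h0.le, ← Real.rpow_mul h0.le, mul_comm]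
  · push Not at h
    rw [uu_off h, uu_off h]; simp

lemma uu_nonneg {k : ℕ} {ch : ℝ × ℝ → Bool} {c : ℝ} (hc : 0 ≤ c) (x : ℝ) : 0 ≤ uu k ch c x :=
  tsum_nonneg (fun n => indicator_nonneg (fun _ _ => by positivity) _)

lemma uu_ofReal {k : ℕ} (hk : 3000 < k) {ch : ℝ × ℝ → Bool} {c : ℝ} (x : ℝ) :
    ENNReal.ofReal (uu k ch c x) =
      ∑' n, (GG k ch n).indicator (fun _ => ENNReal.ofReal (c ^ (n + 1))) x := by
  by_cases h : ∃ n, x ∈ GG k ch n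
  · obtain ⟨n, hn⟩ := h
    rw [uu_on hk hn, tsum_eq_single n, indicator_of_mem hn]
    intro m hm
    exact indicator_of_notMem (fun h' => hm (G_disj hk h' hn)) _
  · push Not at h
    rw [uu_off h]
    simp [indicator_of_notMem (h _)]

lemma uu_meas {k : ℕ} (hk : 3000 < k) {ch : ℝ × ℝ → Bool} {c : ℝ} (hc : 0 ≤ c) :
    Measurable (uu k ch c) := by
  have : uu k ch c = fun x => (ENNReal.ofReal (uu k ch c x)).toReal := by
    funext x; rw [ENNReal.toReal_ofReal (uu_nonneg hc x)]
  rw [this]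
  apply Measurable.ennreal_toReal
  simp_rw [uu_ofReal hk]
  exact Measurable.tsum (fun n => measurable_const.indicator (G_meas k ch n))

lemma lint {k : ℕ} (hk : 3000 < k) {ch : ℝ × ℝ → Bool} {c : ℝ} (A : Set ℝ) :
    ∫⁻ x in A, ENNReal.ofReal (uu k ch c x) =
      ∑' n, ENNReal.ofReal (c ^ (n + 1)) * volume (GG k ch n ∩ A) := by
  simp_rw [uu_ofReal hk]
  rw [lintegral_tsum (fun n => (measurable_const.indicator (G_meas k ch n)).aemeasurable)]
  congr 1
  funext n
  rw [lintegral_indicator (G_meas k ch n), lintegral_const, Measure.restrict_apply_univ,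
    Measure.restrict_apply (G_meas k ch n)]

lemma vol_iv {I : ℝ × ℝ} : volume (ivSet I) = ENNReal.ofReal (len I) := by
  simp [ivSet, len]

lemma vol_G {k : ℕ} (hk : 3000 < k) {ch : ℝ × ℝ → Bool} (m : ℕ) : ∀ {i : ℕ} {K : ℝ × ℝ},
    K ∈ Kfam k i → volume (GG k ch (i + m) ∩ ivSet K) =
      ENNReal.ofReal ((1 / 3) ^ m * (rr k * len K)) := by
  induction m with
  | zero =>
    intro i K h
    have : GG k ch (i + 0) ∩ ivSet K = ivSet (IJ k ch (mid K)) := by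
      ext x
      constructor
      · rintro ⟨h1, h2⟩
        exact G_self hk h h2 h1
      · intro hx
        exact ⟨⟨K, h, hx⟩, IJ_sub hk (len_pos h) hx⟩
    rw [this, vol_iv, len_IJ]; simp
  | succ m ih =>
    intro i K h
    have hK := len_pos h
    have : GG k ch (i + (m + 1)) ∩ ivSet K =
        ⋃ j ∈ Finset.range (3 ^ (k - 1)), (GG k ch (i + 1 + m) ∩ ivSet (child k K j)) := by
      ext x
      simp only [mem_iUnion, Finset.mem_range, mem_inter_iff, exists_prop]
      rw [show i + 1 + m = i + (m + 1) by ring]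
      constructor
      · rintro ⟨h1, h2⟩
        have := G_gt hk (by omega) h h2 h1
        obtain ⟨j, hj, hx⟩ := exists_child hk hK this
        exact ⟨j, hj, h1, hx⟩
      · rintro ⟨j, hj, h1, h2⟩
        exact ⟨h1, mid_sub hK (child_sub_mid hk hK hj h2)⟩
    rw [this, measure_biUnion_finset]
    · rw [Finset.sum_congr rfl (fun j hj => ih (i := i + 1) (K := child k K j)
        (mem_succ.2 ⟨K, h, j, Finset.mem_range.1 hj, rfl⟩))]
      simp_rw [len_child]
      rw [Finset.sum_const, Finset.card_range, nsmul_eq_mul, ← ENNReal.ofReal_natCast,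
        ← ENNReal.ofReal_mul (by positivity)]
      congr 1
      push_cast
      have := n3 hk
      rw [pow_succ]
      linear_combination ((1 / 3) ^ m * (rr k * len K) / 3) * this
    · intro a _ b _ hab
      rw [Function.onFun, Set.disjoint_left]
      rintro x ⟨_, hx⟩ ⟨_, hx'⟩
      exact hab (child_disj hK hx hx')
    · intro j _
      exact (G_meas _ _ _).inter (iv_meas _)

lemma lint_K {k : ℕ} (hk : 3000 < k) {ch : ℝ × ℝ → Bool} {c : ℝ} (hc : 0 < c) (hc3 : c < 3)
    {i : ℕ} {K : ℝ × ℝ} (h : K ∈ Kfam k i) :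
    ∫⁻ x in ivSet K, ENNReal.ofReal (uu k ch c x) =
      ENNReal.ofReal (c ^ (i + 1) * (rr k * len K) * (1 - c / 3)⁻¹) := by
  rw [lint hk, ← ENNReal.summable.sum_add_tsum_nat_add' (k := i), Finset.sum_eq_zero, zero_add]
  · have hl := mul_pos (rr_pos k) (len_pos h)
    have e : ∀ m : ℕ, ENNReal.ofReal (c ^ (m + i + 1)) * volume (GG k ch (m + i) ∩ ivSet K) =
        ENNReal.ofReal ((c ^ (i + 1) * (rr k * len K)) * (c / 3) ^ m) := by
      intro m
      rw [add_comm m i, vol_G hk m h, ← ENNReal.ofReal_mul (by positivity)]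
      congr 1
      rw [div_pow, div_pow]; ring
    simp_rw [e]
    rw [← ENNReal.ofReal_tsum_of_nonneg]
    · rw [tsum_mul_left, tsum_geometric_of_lt_one (by positivity) (by linarith)]
    · intro n; positivity
    · exact (summable_geometric_of_lt_one (by positivity) (by linarith)).mul_left _
  · intro n hn
    have : GG k ch n ∩ ivSet K = ∅ := by
      ext x
      simp only [mem_inter_iff, mem_empty_iff_false, iff_false]
      rintro ⟨h1, h2⟩
      exact G_lt hk (Finset.mem_range.1 hn) h h2 h1
    simp [this]

lemma int_K {k : ℕ} (hk : 3000 < k) {ch : ℝ × ℝ → Bool} {c : ℝ} (hc : 0 < c) (hc3 : c < 3)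
    {i : ℕ} {K : ℝ × ℝ} (h : K ∈ Kfam k i) : IntegrableOn (uu k ch c) (ivSet K) := by
  refine ⟨(uu_meas hk hc.le).aestronglyMeasurable, ?_⟩
  rw [hasFiniteIntegral_iff_ofReal (Eventually.of_forall (uu_nonneg hc.le)), lint_K hk hc hc3 h]
  exact ENNReal.ofReal_lt_top

lemma mass_K {k : ℕ} (hk : 3000 < k) {ch : ℝ × ℝ → Bool} {c : ℝ} (hc : 0 < c) (hc3 : c < 3)
    {i : ℕ} {K : ℝ × ℝ} (h : K ∈ Kfam k i) :
    mass (uu k ch c) K = c ^ (i + 1) * (rr k * len K) * (1 - c / 3)⁻¹ := by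
  unfold mass
  rw [integral_eq_lintegral_of_nonneg_ae (Eventually.of_forall (uu_nonneg hc.le))
    (uu_meas hk hc.le).aestronglyMeasurable, lint_K hk hc hc3 h, ENNReal.toReal_ofReal]
  have hl := mul_pos (rr_pos k) (len_pos h)
  have : 0 < 1 - c / 3 := by linarith
  positivity

lemma sum_vol_le {ι : Type*} (T : Finset ι) (E : ι → Set ℝ) (hm : ∀ j ∈ T, MeasurableSet (E j))
    (hd : ∀ i ∈ T, ∀ j ∈ T, i ≠ j → Disjoint (E i) (E j)) {A B : ℝ} (hAB : A ≤ B)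
    (hs : ∀ j ∈ T, E j ⊆ Ico A B) : ∑ j ∈ T, volume.real (E j) ≤ B - A := by
  have hsub : (⋃ j ∈ T, E j) ⊆ Ico A B := iUnion₂_subset hs
  have hfin : volume (Ico A B) ≠ ⊤ := by simp
  rw [← measureReal_biUnion_finset (fun i hi j hj => hd i hi j hj) hm
    (fun j hj => ((measure_mono (hs j hj)).trans_lt hfin.lt_top).ne)]
  calc _ ≤ volume.real (Ico A B) := measureReal_mono hsub hfin
    _ = B - A := by simp [hAB]

lemma volr_iv {I : ℝ × ℝ} (h : 0 ≤ len I) : volume.real (ivSet I) = len I := by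
  rw [measureReal_def, vol_iv, ENNReal.toReal_ofReal h]

lemma mass_mid {k : ℕ} (hk : 3000 < k) {ch : ℝ × ℝ → Bool} {c : ℝ} (hc : 0 < c) (hc3 : c < 3)
    {i : ℕ} {K : ℝ × ℝ} (h : K ∈ Kfam k i) {I : ℝ × ℝ} (hI : I.1 < I.2) :
    ∫ x in ivSet I ∩ ivSet (mid K), uu k ch c x ≤
      (len I / (rr k * len K) + 2) *
        (c ^ (i + 2) * (rr k * (rr k * len K)) * (1 - c / 3)⁻¹) := by
  classical
  have hK := len_pos h
  have hl := mul_pos (rr_pos k) hK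
  have hcc : 0 < 1 - c / 3 := by linarith
  set T := (Finset.range (3 ^ (k - 1))).filter
    (fun j => (ivSet (child k K j) ∩ ivSet I).Nonempty) with hT
  have hmem : ∀ j ∈ T, child k K j ∈ Kfam k (i + 1) := fun j hj =>
    mem_succ.2 ⟨K, h, j, Finset.mem_range.1 (Finset.mem_filter.1 hj).1, rfl⟩
  have hdis : ∀ i ∈ T, ∀ j ∈ T, i ≠ j → Disjoint (ivSet (child k K i)) (ivSet (child k K j)) := by
    intro i _ j _ hij
    rw [Set.disjoint_left]
    intro x hx hx'
    exact hij (child_disj hK hx hx')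
  have hcard : (T.card : ℝ) * (rr k * len K) ≤ len I + 2 * (rr k * len K) := by
    have := sum_vol_le T (fun j => ivSet (child k K j)) (fun _ _ => iv_meas _) hdis
      (A := I.1 - rr k * len K) (B := I.2 + rr k * len K) (by linarith) ?_
    · rw [Finset.sum_congr rfl (g := fun _ => rr k * len K)
        (fun j hj => by rw [volr_iv (by rw [len_child]; exact hl.le), len_child])] at this
      rw [Finset.sum_const, nsmul_eq_mul] at this
      rw [show len I = I.2 - I.1 from rfl]
      linarith
    · intro j hj x hx
      obtain ⟨y, hy, hy'⟩ := (Finset.mem_filter.1 hj).2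
      rw [mem_iv, child_fst, child_snd] at hx hy
      rw [mem_iv] at hy'
      constructor <;> linarith
  have hint : IntegrableOn (uu k ch c) (⋃ j ∈ T, ivSet (child k K j)) :=
    (integrableOn_finset_iUnion).2 (fun j hj => int_K hk hc hc3 (hmem j hj))
  calc ∫ x in ivSet I ∩ ivSet (mid K), uu k ch c x
      ≤ ∫ x in ⋃ j ∈ T, ivSet (child k K j), uu k ch c x := by
        apply setIntegral_mono_set hint (Eventually.of_forall (uu_nonneg hc.le))
        apply LE.le.eventuallyLE
        rintro x ⟨hx, hx'⟩
        obtain ⟨j, hj, hxj⟩ := exists_child hk hK hx'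
        exact mem_biUnion (Finset.mem_coe.2 (Finset.mem_filter.2
          ⟨Finset.mem_range.2 hj, ⟨x, hxj, hx⟩⟩)) hxj
    _ = ∑ j ∈ T, ∫ x in ivSet (child k K j), uu k ch c x :=
        integral_biUnion_finset _ (fun _ _ => iv_meas _) (fun i hi j hj => hdis i hi j hj)
          (fun j hj => int_K hk hc hc3 (hmem j hj))
    _ = ∑ j ∈ T, (c ^ (i + 2) * (rr k * (rr k * len K)) * (1 - c / 3)⁻¹) := by
        apply Finset.sum_congr rfl
        intro j hj
        have := mass_K (ch := ch) hk hc hc3 (hmem j hj)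
        rw [len_child] at this
        exact this
    _ = T.card * (c ^ (i + 2) * (rr k * (rr k * len K)) * (1 - c / 3)⁻¹) := by
        rw [Finset.sum_const, nsmul_eq_mul]
    _ ≤ _ := by
        have := rr_pos k
        apply mul_le_mul_of_nonneg_right _ (by positivity)
        rw [div_add' _ _ _ hl.ne', le_div_iff₀ hl]
        exact hcard

lemma mass_split {k : ℕ} (hk : 3000 < k) {ch : ℝ × ℝ → Bool} {c : ℝ} (hc : 0 < c) (hc3 : c < 3)
    {i : ℕ} {K : ℝ × ℝ} (h : K ∈ Kfam k i) {I : ℝ × ℝ} (hIK : ivSet I ⊆ ivSet K) :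
    mass (uu k ch c) I ≤ c ^ (i + 1) * volume.real (ivSet I ∩ ivSet (IJ k ch (mid K))) +
      ∫ x in ivSet I ∩ ivSet (mid K), uu k ch c x := by
  have hint := (int_K (ch := ch) hk hc hc3 h).mono_set hIK
  have hle : ∀ x ∈ ivSet I, uu k ch c x ≤
      (ivSet (IJ k ch (mid K))).indicator (fun _ => c ^ (i + 1)) x +
      (ivSet (mid K)).indicator (uu k ch c) x := by
    intro x hx
    have n1 : 0 ≤ (ivSet (IJ k ch (mid K))).indicator (fun _ => c ^ (i + 1)) x :=
      indicator_nonneg (fun _ _ => by positivity) _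
    have n2 : 0 ≤ (ivSet (mid K)).indicator (uu k ch c) x :=
      indicator_nonneg (fun y _ => uu_nonneg hc.le y) _
    by_cases hG : ∃ n, x ∈ GG k ch n
    · obtain ⟨n, hn⟩ := hG
      rcases G_cases hk h (hIK hx) hn with ⟨rfl, h1⟩ | ⟨-, h1⟩
      · rw [indicator_of_mem h1, uu_on hk hn]; linarith
      · rw [indicator_of_mem h1]; linarith
    · push Not at hG
      rw [uu_off hG]; linarith
  have hc1 : IntegrableOn ((ivSet (IJ k ch (mid K))).indicator (fun _ => c ^ (i + 1))) (ivSet I) := by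
    apply Integrable.indicator _ (iv_meas _)
    exact integrableOn_const (by simp [vol_iv]) (by simp)
  have hc2 : IntegrableOn ((ivSet (mid K)).indicator (uu k ch c)) (ivSet I) :=
    hint.indicator (iv_meas _)
  calc mass (uu k ch c) I ≤ ∫ x in ivSet I, ((ivSet (IJ k ch (mid K))).indicator (fun _ => c ^ (i + 1)) x +
      (ivSet (mid K)).indicator (uu k ch c) x) :=
        setIntegral_mono_on hint (hc1.add hc2) (iv_meas _) hle
    _ = _ := by
      rw [integral_add hc1 hc2, setIntegral_indicator (iv_meas _), setIntegral_indicator (iv_meas _),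
        setIntegral_const, smul_eq_mul, mul_comm]

/-- Local finiteness of `S` between members of `F`. -/
def LF (S : Set (ℝ × ℝ)) (F : Finset (ℝ × ℝ)) : Prop :=
  ∀ I ∈ F, ∀ I' ∈ F, {Q | Q ∈ S ∧ ivSet I ⊆ ivSet Q ∧ ivSet Q ⊆ ivSet I'}.Finite

lemma iv_sub {I I' : ℝ × ℝ} (h : I.1 < I.2) : ivSet I ⊆ ivSet I' ↔ I'.1 ≤ I.1 ∧ I.2 ≤ I'.2 :=
  Ico_subset_Ico_iff h

lemma iv_inj {I I' : ℝ × ℝ} (h : I.1 < I.2) (h' : I'.1 < I'.2) (e : ivSet I = ivSet I') :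
    I = I' := by
  have h1 := (iv_sub h).1 e.le
  have h2 := (iv_sub h').1 e.ge
  exact Prod.ext (le_antisymm h2.1 h1.1) (le_antisymm h1.2 h2.2)

lemma E_vol {ε : ℝ} {S : Set (ℝ × ℝ)} (hS : MSparse ε S) {R : ℝ × ℝ} (hR : R ∈ S) :
    (1 - ε) * len R ≤ volume.real (ivSet R \ ⋃ Q ∈ maxIn S R, ivSet Q) := by
  obtain ⟨hc, hp, hn, hsp⟩ := hS
  have hsub : (⋃ Q ∈ maxIn S R, ivSet Q) ⊆ ivSet R := iUnion₂_subset (fun Q hQ => hQ.2.1.1)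
  have hcm : (maxIn S R).Countable := hc.mono (fun Q hQ => hQ.1)
  have hlen : ∀ I ∈ S, 0 ≤ len I := fun I hI => by have := hp I hI; rw [len]; linarith
  have hU : volume.real (⋃ Q ∈ maxIn S R, ivSet Q) = ∑' Q : ↥(maxIn S R), len (Q : ℝ × ℝ) := by
    rw [measureReal_def, measure_biUnion hcm _ (fun _ _ => iv_meas _), ENNReal.tsum_toReal_eq]
    · congr 1; funext Q
      rw [vol_iv, ENNReal.toReal_ofReal (hlen _ Q.2.1)]
    · intro Q; simp [vol_iv]
    · intro Q hQ Q' hQ' hne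
      rw [Function.onFun]
      rcases hn Q hQ.1 Q' hQ'.1 with h | h | h
      · exact (hne (iv_inj (hp _ hQ.1) (hp _ hQ'.1) (hQ.2.2 Q' hQ'.1 h hQ'.2.1).symm)).elim
      · exact (hne (iv_inj (hp _ hQ.1) (hp _ hQ'.1) (hQ'.2.2 Q hQ.1 h hQ.2.1))).elim
      · exact Set.disjoint_iff_inter_eq_empty.2 h
  have hfin : volume (ivSet R) ≠ ⊤ := by simp [vol_iv]
  rw [measureReal_sdiff hsub (MeasurableSet.biUnion hcm (fun _ _ => iv_meas _)) 
     , hU, volr_iv (hlen R hR)]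
  have := hsp R hR
  linarith

lemma carleson {ε : ℝ} (hε : ε < 1) {S : Set (ℝ × ℝ)} (hS : MSparse ε S) {F : Finset (ℝ × ℝ)}
    (hF : ∀ I ∈ F, I ∈ S) (hLF : LF S F) {A B : ℝ} (hAB : A ≤ B)
    (hsub : ∀ I ∈ F, ivSet I ⊆ Ico A B) : ∑ I ∈ F, len I ≤ (B - A) / (1 - ε) := by
  have hS' := hS
  obtain ⟨hc, hp, hn, hsp⟩ := hS
  rw [le_div_iff₀ (by linarith)]
  have key : ∀ I ∈ F, ∀ I' ∈ F, I ≠ I' → ivSet I ⊆ ivSet I' →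
      ∃ Q ∈ maxIn S I', ivSet I ⊆ ivSet Q := by
    intro I hI I' hI' hne hs
    have hss : ivSet I ⊂ ivSet I' := by
      refine hs.ssubset_of_ne (fun e => hne (iv_inj (hp _ (hF _ hI)) (hp _ (hF _ hI')) e))
    have hf : {Q | Q ∈ S ∧ ivSet I ⊆ ivSet Q ∧ ivSet Q ⊂ ivSet I'}.Finite :=
      (hLF I hI I' hI').subset (fun Q hQ => ⟨hQ.1, hQ.2.1, hQ.2.2.1⟩)
    obtain ⟨Q, hQ, hmax⟩ := Set.exists_max_image _ len hf ⟨I, hF _ hI, Subset.rfl, hss⟩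
    refine ⟨Q, ⟨hQ.1, hQ.2.2, ?_⟩, hQ.2.1⟩
    intro Q' hQ' h1 h2
    have h3 := hmax Q' ⟨hQ', hQ.2.1.trans h1, h2⟩
    have h4 := (iv_sub (hp _ hQ.1)).1 h1
    have h5 := hp _ hQ.1
    rw [len, len] at h3
    congr 1
    exact Prod.ext (by linarith) (by linarith)
  have := sum_vol_le F (fun R => ivSet R \ ⋃ Q ∈ maxIn S R, ivSet Q)
    (fun R _ => (iv_meas R).diff (MeasurableSet.biUnion (hc.mono (fun Q hQ => hQ.1))
      (fun _ _ => iv_meas _))) ?_ hAB (fun I hI => sdiff_subset.trans (hsub I hI))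
  · refine le_trans ?_ this
    rw [Finset.sum_mul]
    apply Finset.sum_le_sum
    intro I hI
    rw [mul_comm]
    exact E_vol hS' (hF I hI)
  · have aux : ∀ I ∈ F, ∀ I' ∈ F, I ≠ I' → ivSet I ⊆ ivSet I' →
      Disjoint (ivSet I \ ⋃ Q ∈ maxIn S I, ivSet Q) (ivSet I' \ ⋃ Q ∈ maxIn S I', ivSet Q) := by
      intro I hI I' hI' hne hs
      obtain ⟨Q, hQ, hIQ⟩ := key I hI I' hI' hne hs
      rw [Set.disjoint_left]
      rintro x ⟨hx, -⟩ ⟨-, hx'⟩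
      exact hx' (mem_biUnion hQ (hIQ hx))
    intro I hI I' hI' hne
    rcases hn I (hF _ hI) I' (hF _ hI') with h | h | h
    · exact aux I hI I' hI' hne h
    · exact (aux I' hI' I hI hne.symm h).symm
    · exact (Set.disjoint_iff_inter_eq_empty.2 h).mono sdiff_subset sdiff_subset

lemma LF_mono {S : Set (ℝ × ℝ)} {F F' : Finset (ℝ × ℝ)} (h : F' ⊆ F) (hF : LF S F) : LF S F' :=
  fun I hI I' hI' => hF I (h hI) I' (h hI')

lemma min_le {k : ℕ} {x l : ℝ} (hx : 0 < x) (hxl : x ≤ 3 ^ k * l) :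
    min x l ≤ ∑ j ∈ Finset.range (k + 1), if x ≤ 3 ^ j * l then 3 * (1 / 3 : ℝ) ^ j * x else 0 := by
  classical
  have hex : ∃ j : ℕ, x ≤ 3 ^ j * l := ⟨k, hxl⟩
  set j := Nat.find hex with hj
  have h1 : x ≤ 3 ^ j * l := Nat.find_spec hex
  have hjk : j ≤ k := Nat.find_min' hex hxl
  have h2 : min x l ≤ if x ≤ 3 ^ j * l then 3 * (1 / 3 : ℝ) ^ j * x else 0 := by
    rw [if_pos h1]
    rcases Nat.eq_zero_or_pos j with h0 | h0
    · rw [h0]; apply (min_le_left _ _).trans; linarith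
    · obtain ⟨m, hm⟩ : ∃ m, j = m + 1 := ⟨j - 1, by omega⟩
      have h3 : ¬ x ≤ 3 ^ m * l := Nat.find_min hex (by omega)
      push Not at h3
      rw [hm]
      apply (min_le_right _ _).trans
      have h4 : (1 / 3 : ℝ) ^ m * (3 ^ m * l) ≤ (1 / 3 : ℝ) ^ m * x := by gcongr
      have h5 : (1 / 3 : ℝ) ^ m * (3 ^ m * l) = l := by
        rw [← mul_assoc, ← mul_pow]; norm_num
      rw [pow_succ]
      linarith
  refine h2.trans ?_
  apply Finset.single_le_sum (f := fun j => if x ≤ 3 ^ j * l then 3 * (1 / 3 : ℝ) ^ j * x else 0)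
    _ (Finset.mem_range.2 (by omega))
  intro i _
  split_ifs <;> positivity

lemma tau_sum {ε : ℝ} (hε : ε < 1) {S : Set (ℝ × ℝ)} (hS : MSparse ε S) {F : Finset (ℝ × ℝ)}
    (hF : ∀ I ∈ F, I ∈ S) (hLF : LF S F) {L : ℝ × ℝ} (hL : 0 < len L) {k : ℕ} (hk : 1 ≤ k)
    (hIL : ∀ I ∈ F, (ivSet I ∩ ivSet L).Nonempty) (hlen : ∀ I ∈ F, len I ≤ 3 ^ k * len L) :
    ∑ I ∈ F, min (len I) (len L) ≤ 18 * k * len L / (1 - ε) := by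
  classical
  have hpos : ∀ I ∈ F, 0 < len I := fun I hI => by
    have := hS.2.1 I (hF I hI); rw [len]; linarith
  have hε' : 0 < 1 - ε := by linarith
  calc ∑ I ∈ F, min (len I) (len L)
      ≤ ∑ I ∈ F, ∑ j ∈ Finset.range (k + 1),
        (if len I ≤ 3 ^ j * len L then 3 * (1 / 3 : ℝ) ^ j * len I else 0) :=
        Finset.sum_le_sum (fun I hI => min_le (hpos I hI) (hlen I hI))
    _ = ∑ j ∈ Finset.range (k + 1), 3 * (1 / 3 : ℝ) ^ j *
          ∑ I ∈ F.filter (fun I => len I ≤ 3 ^ j * len L), len I := by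
        rw [Finset.sum_comm]
        apply Finset.sum_congr rfl
        intro j _
        rw [Finset.mul_sum, Finset.sum_filter]
    _ ≤ ∑ j ∈ Finset.range (k + 1), 9 * len L / (1 - ε) := by
        apply Finset.sum_le_sum
        intro j _
        have h1 : (1 : ℝ) ≤ 3 ^ j := one_le_pow₀ (by norm_num)
        have h3 : (1 / 3 : ℝ) ^ j * 3 ^ j = 1 := by rw [← mul_pow]; norm_num
        have h0 : len L ≤ 3 ^ j * len L := by nlinarith
        have hLe : L.2 = L.1 + len L := snd_eq L
        have := carleson hε hS (F := F.filter (fun I => len I ≤ 3 ^ j * len L))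
          (fun I hI => hF I (Finset.mem_filter.1 hI).1) (LF_mono (Finset.filter_subset _ _) hLF)
          (A := L.1 - 3 ^ j * len L) (B := L.2 + 3 ^ j * len L) (by linarith) ?_
        · calc 3 * (1 / 3 : ℝ) ^ j * ∑ I ∈ F.filter (fun I => len I ≤ 3 ^ j * len L), len I
              ≤ 3 * (1 / 3 : ℝ) ^ j * ((3 * (3 ^ j * len L)) / (1 - ε)) := by
                gcongr
                refine this.trans ?_
                gcongr
                linarith
            _ = 9 * ((1 / 3 : ℝ) ^ j * 3 ^ j) * len L / (1 - ε) := by ring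
            _ = 9 * len L / (1 - ε) := by rw [h3]; ring
        · intro I hI x hx
          have h4 := (Finset.mem_filter.1 hI).2
          obtain ⟨y, hy, hy'⟩ := hIL I (Finset.mem_filter.1 hI).1
          rw [mem_iv] at hx hy hy'
          rw [len] at h4
          constructor <;> linarith
    _ = 9 * (k + 1) * len L / (1 - ε) := by
        rw [Finset.sum_const, Finset.card_range, nsmul_eq_mul]; push_cast; ring
    _ ≤ _ := by
        have : (1 : ℝ) ≤ k := by exact_mod_cast hk
        apply div_le_div_of_nonneg_right _ hε'.le
        apply mul_le_mul_of_nonneg_right _ hL.le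
        linarith

lemma mass_nonneg {u : ℝ → ℝ} (hu : ∀ x, 0 ≤ u x) (I : ℝ × ℝ) : 0 ≤ mass u I :=
  integral_nonneg hu

lemma mass_mono {u : ℝ → ℝ} (hu : ∀ x, 0 ≤ u x) {I I' : ℝ × ℝ} (h : ivSet I ⊆ ivSet I')
    (hi : IntegrableOn u (ivSet I')) : mass u I ≤ mass u I' :=
  setIntegral_mono_set hi (Eventually.of_forall hu) (LE.le.eventuallyLE h)

lemma sumTest_le {S 𝓕 : Set (ℝ × ℝ)} (hFS : 𝓕 ⊆ S) (hp : ∀ I ∈ S, I.1 < I.2)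
    (hconv : ∀ I ∈ 𝓕, ∀ I' ∈ 𝓕, ∀ Q ∈ S, ivSet I ⊆ ivSet Q → ivSet Q ⊆ ivSet I' → Q ∈ 𝓕)
    {u v : ℝ → ℝ} (hu : ∀ x, 0 ≤ u x) (hv : ∀ x, 0 ≤ v x)
    (hui : ∀ I ∈ 𝓕, IntegrableOn u (ivSet I)) (hvi : ∀ I ∈ 𝓕, IntegrableOn v (ivSet I))
    {q : ℝ} (hq : 0 < q) {M : ℝ} (hM0 : 0 ≤ M)
    (hM : ∀ F : Finset (ℝ × ℝ), (∀ I ∈ F, I ∈ 𝓕 ∧ 0 < mass u I ∧ 0 < mass v I) → LF S F →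
      ∑ I ∈ F, avg u I ^ q * avg v I * len I ≤ M) : sumTest q u v 𝓕 ≤ M := by
  classical
  unfold sumTest
  by_cases hs : Summable (fun I : ↥𝓕 => avg u (I : ℝ × ℝ) ^ q * avg v (I : ℝ × ℝ) * len (I : ℝ × ℝ))
  swap
  · rw [tsum_eq_zero_of_not_summable hs]; exact hM0
  apply hs.tsum_le_of_sum_le
  intro s
  set F := (s.map (Function.Embedding.subtype _)).filter (fun I => 0 < mass u I ∧ 0 < mass v I) with hFdef
  have hF : ∀ I ∈ F, I ∈ 𝓕 ∧ 0 < mass u I ∧ 0 < mass v I := by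
    intro I hI
    obtain ⟨h1, h2⟩ := Finset.mem_filter.1 hI
    obtain ⟨x, -, rfl⟩ := Finset.mem_map.1 h1
    exact ⟨x.2, h2⟩
  have hlen : ∀ I ∈ 𝓕, 0 < len I := fun I hI => by
    have := hp I (hFS hI); rw [len]; linarith
  have e : ∑ I ∈ s, avg u (I : ℝ × ℝ) ^ q * avg v (I : ℝ × ℝ) * len (I : ℝ × ℝ) =
      ∑ I ∈ F, avg u I ^ q * avg v I * len I := by
    rw [hFdef, Finset.sum_filter_of_ne, Finset.sum_map]
    · rfl
    · intro I _ hne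
      constructor
      · refine (mass_nonneg hu I).lt_of_ne (fun h0 => hne ?_)
        simp [avg, ← h0, Real.zero_rpow hq.ne']
      · refine (mass_nonneg hv I).lt_of_ne (fun h0 => hne ?_)
        simp [avg, ← h0]
  rw [e]
  apply hM F hF
  intro I hI I' hI'
  obtain ⟨h1, h2, h3⟩ := hF I hI
  obtain ⟨h1', -, -⟩ := hF I' hI'
  have hl' := hlen I' h1'
  set δ := (mass u I / len I') ^ q * mass v I with hδ
  have hδ0 : 0 < δ := by positivity
  have hfin : {x : ↥𝓕 | ¬ (avg u (x : ℝ × ℝ) ^ q * avg v (x : ℝ × ℝ) * len (x : ℝ × ℝ) < δ)}.Finite :=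
    (hs.tendsto_cofinite_zero.eventually (gt_mem_nhds hδ0))
  refine (hfin.image Subtype.val).subset ?_
  rintro Q ⟨hQ, hIQ, hQI'⟩
  have hQF := hconv I h1 I' h1' Q hQ hIQ hQI'
  refine ⟨⟨Q, hQF⟩, ?_, rfl⟩
  have hlQ := hlen Q hQF
  have hll : len Q ≤ len I' := by
    have := (iv_sub (hp Q hQ)).1 hQI'
    rw [len, len]; linarith
  simp only [mem_ofPred_eq, not_lt]
  rw [mul_assoc, show avg v Q * len Q = mass v Q by rw [avg]; field_simp, hδ, avg]
  have m1 := mass_mono hu hIQ (hui Q hQF)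
  have m2 := mass_mono hv hIQ (hvi Q hQF)
  have m3 : 0 ≤ mass u Q := mass_nonneg hu Q
  gcongr

lemma aa_mul (k : ℕ) : aa k * (3 ^ (k - 1) + 1) = 3 ^ k := by
  unfold aa; field_simp

lemma aa_lt {k : ℕ} (hk : 3000 < k) : aa k < 3 := by
  unfold aa
  rw [div_lt_iff₀ (by positivity)]
  obtain ⟨m, rfl⟩ : ∃ m, k = m + 1 := ⟨k - 1, by omega⟩
  simp [pow_succ]; linarith

lemma aa_ge {k : ℕ} (hk : 3000 < k) : 1 ≤ aa k := by
  unfold aa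
  rw [le_div_iff₀ (by positivity)]
  obtain ⟨m, rfl⟩ : ∃ m, k = m + 1 := ⟨k - 1, by omega⟩
  have : (1 : ℝ) ≤ 3 ^ m := one_le_pow₀ (by norm_num)
  simp [pow_succ]; linarith

lemma aa_inv {k : ℕ} (hk : 3000 < k) : (1 - aa k / 3)⁻¹ = 3 ^ (k - 1) + 1 := by
  unfold aa
  obtain ⟨m, rfl⟩ : ∃ m, k = m + 1 := ⟨k - 1, by omega⟩
  have h : (0 : ℝ) < 3 ^ m + 1 := by positivity
  simp only [Nat.add_sub_cancel, pow_succ]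
  rw [inv_eq_iff_eq_inv]
  field_simp
  ring

lemma mass_w_mid {k : ℕ} (hk : 3000 < k) {ch : ℝ × ℝ → Bool}
    {i : ℕ} {K : ℝ × ℝ} (h : K ∈ Kfam k i) {I : ℝ × ℝ} (hI : I.1 < I.2) :
    ∫ x in ivSet I ∩ ivSet (mid K), uu k ch (aa k) x ≤
      aa k ^ (i + 1) * (len I + 2 * (rr k * len K)) := by
  refine (mass_mid hk (aa_pos k) (aa_lt hk) h hI).trans (le_of_eq ?_)
  have hl := mul_pos (rr_pos k) (len_pos h)
  rw [aa_inv hk]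
  have h1 := aa_mul k
  have h2 := pow_rr k
  have h3 : aa k ^ (i + 2) * (rr k * (rr k * len K)) * (3 ^ (k - 1) + 1) =
      aa k ^ (i + 1) * (rr k * len K) := by
    rw [pow_succ (aa k) (i + 1)]
    linear_combination (aa k ^ (i + 1) * (rr k * (rr k * len K))) * h1 +
      (aa k ^ (i + 1) * (rr k * len K)) * h2
  rw [h3]
  set l := rr k * len K
  field_simp

lemma mass_s_mid {k : ℕ} (hk : 3000 < k) {ch : ℝ × ℝ → Bool} {b : ℝ} (hb : 0 < b) (hb1 : b ≤ 1)
    {i : ℕ} {K : ℝ × ℝ} (h : K ∈ Kfam k i) {I : ℝ × ℝ} (hI : I.1 < I.2) :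
    ∫ x in ivSet I ∩ ivSet (mid K), uu k ch b x ≤
      b ^ (i + 1) * (3 / 2 * rr k * (len I + 2 * (rr k * len K))) := by
  refine (mass_mid hk hb (by linarith) h hI).trans ?_
  have hr := rr_pos k
  have hl := mul_pos hr (len_pos h)
  have hlI : 0 < len I := by rw [len]; linarith
  have h1 : (1 - b / 3)⁻¹ ≤ 3 / 2 := by
    rw [inv_le_comm₀ (by linarith) (by norm_num)]; linarith
  have h2 : b ^ (i + 2) ≤ b ^ (i + 1) := pow_le_pow_of_le_one hb.le hb1 (by omega)
  have h0 : 0 < 1 - b / 3 := by linarith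
  calc _ ≤ (len I / (rr k * len K) + 2) * (b ^ (i + 1) * (rr k * (rr k * len K)) * (3 / 2)) := by
        gcongr
    _ = _ := by
        set l := rr k * len K
        field_simp

lemma iv_len_le {K I : ℝ × ℝ} (hI : I.1 < I.2) (h : ivSet I ⊆ ivSet K) : len I ≤ len K := by
  have := (iv_sub hI).1 h
  rw [len, len]; linarith

lemma vol_inter_le {I L : ℝ × ℝ} (hI : 0 ≤ len I) (hL : 0 ≤ len L) :
    volume.real (ivSet I ∩ ivSet L) ≤ min (len I) (len L) := by
  apply le_min
  · rw [← volr_iv hI]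
    exact measureReal_mono inter_subset_left (by simp [vol_iv])
  · rw [← volr_iv hL]
    exact measureReal_mono inter_subset_right (by simp [vol_iv])

/-- The conclusion from good bounds on the averages. -/
lemma final {p : ℝ} (hp : 1 < p) {k : ℕ} (hk : 3000 < k) {ch : ℝ × ℝ → Bool} {ε : ℝ}
    (hε1 : ε < 1) {S : Set (ℝ × ℝ)} (hS : MSparse ε S) {i : ℕ} {K : ℝ × ℝ}
    (h : K ∈ Kfam k i) {𝓕 : Set (ℝ × ℝ)} (hFS : 𝓕 ⊆ S) (hFK : ∀ I ∈ 𝓕, ivSet I ⊆ ivSet K)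
    (hconv : ∀ I ∈ 𝓕, ∀ I' ∈ 𝓕, ∀ Q ∈ S, ivSet I ⊆ ivSet Q → ivSet Q ⊆ ivSet I' → Q ∈ 𝓕)
    (τ : ℝ × ℝ → ℝ) (hτ0 : ∀ I ∈ 𝓕, 0 ≤ τ I) (hτ1 : ∀ I ∈ 𝓕, τ I ≤ 1)
    (hw : ∀ I ∈ 𝓕, 0 < mass (uu k ch (aa k)) I →
      mass (uu k ch (aa k)) I ≤ 14 * aa k ^ (i + 1) * len I)
    (hσ : ∀ I ∈ 𝓕, 0 < mass (uu k ch (aa k)) I →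
      mass (uu k ch (aa k ^ (1 - p))) I ≤ 14 * (aa k ^ (1 - p)) ^ (i + 1) * τ I * len I)
    (hsum : ∀ F : Finset (ℝ × ℝ), (∀ I ∈ F, I ∈ 𝓕) → LF S F →
      ∑ I ∈ F, τ I * len I ≤ 18 * k * (rr k * len K) / (1 - ε)) :
    sumTest p (wgt k ch) (sgm p k ch) 𝓕 ≤ 54 * (14 ^ (p + 1) + 14 ^ (p / (p - 1) + 1)) *
        ((k : ℝ) * (3 : ℝ) ^ (-(k : ℤ)) * mass (wgt k ch) K) / (1 - ε) ∧
    sumTest (p / (p - 1)) (sgm p k ch) (wgt k ch) 𝓕 ≤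
      54 * (14 ^ (p + 1) + 14 ^ (p / (p - 1) + 1)) *
        ((k : ℝ) * mass (sgm p k ch) K) / (1 - ε) := by
  have hε' : 0 < 1 - ε := by linarith
  have ha := aa_pos k
  have ha1 := aa_ge hk
  have ha3 := aa_lt hk
  set b := aa k ^ (1 - p) with hbdef
  have hb : 0 < b := Real.rpow_pos_of_pos ha _
  have hb1 : b ≤ 1 := Real.rpow_le_one_of_one_le_of_nonpos ha1 (by linarith)
  have hr := rr_pos k
  have hl : 0 < rr k * len K := mul_pos hr (len_pos h)
  have hz : (3 : ℝ) ^ (-(k : ℤ)) = rr k := by rw [zpow_neg, zpow_natCast, rr]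
  set A := aa k ^ (i + 1) with hA
  have hA0 : 0 < A := by positivity
  have hB : b ^ (i + 1) = A ^ (1 - p) := by
    rw [hA, hbdef, ← Real.rpow_natCast, ← Real.rpow_natCast, ← Real.rpow_mul ha.le,
      ← Real.rpow_mul ha.le, mul_comm]
  have hB0 : 0 < A ^ (1 - p) := Real.rpow_pos_of_pos hA0 _
  set P := p / (p - 1) with hP
  have hp1 : 0 < p - 1 := by linarith
  have hP1 : 1 < P := by rw [hP, lt_div_iff₀ hp1]; linarith
  have hlen : ∀ I ∈ 𝓕, 0 < len I := fun I hI => by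
    have := hS.2.1 I (hFS hI); rw [len]; linarith
  rw [wgt_eq hk, sgm_eq hk, ← hbdef, hz]
  have hmw : mass (uu k ch (aa k)) K = A * (rr k * len K) * (3 ^ (k - 1) + 1) := by
    rw [mass_K hk ha ha3 h, aa_inv hk]
  have hms : A ^ (1 - p) * (rr k * len K) ≤ mass (uu k ch b) K := by
    rw [mass_K hk hb (by linarith) h, ← hB]
    apply le_mul_of_one_le_right (by positivity)
    apply (one_le_inv₀ (by linarith)).2; linarith
  have hmw' : A * (rr k * len K) ≤ 3 * (rr k * mass (uu k ch (aa k)) K) := by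
    rw [hmw]
    have h1 : A * (rr k * len K) * 1 ≤ A * (rr k * len K) * (3 * (rr k * (3 ^ (k - 1) + 1))) := by
      gcongr
      have := n3 hk
      linarith
    linarith
  have c1 : (0 : ℝ) < 14 ^ (p + 1) := by positivity
  have c2 : (0 : ℝ) < 14 ^ (P + 1) := by positivity
  have hkk : (0 : ℝ) ≤ k := Nat.cast_nonneg k
  have iw : ∀ I ∈ 𝓕, IntegrableOn (uu k ch (aa k)) (ivSet I) := fun I hI =>
    (int_K hk ha ha3 h).mono_set (hFK I hI)
  have is : ∀ I ∈ 𝓕, IntegrableOn (uu k ch b) (ivSet I) := fun I hI =>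
    (int_K hk hb (by linarith) h).mono_set (hFK I hI)
  have nw := uu_nonneg (k := k) (ch := ch) ha.le
  have ns := uu_nonneg (k := k) (ch := ch) hb.le
  have mw0 := mass_nonneg nw K
  have ms0 := mass_nonneg ns K
  have avw : ∀ I ∈ 𝓕, 0 < mass (uu k ch (aa k)) I → avg (uu k ch (aa k)) I ≤ 14 * A := by
    intro I hI hm
    rw [avg, div_le_iff₀ (hlen I hI)]
    exact hw I hI hm
  have avs : ∀ I ∈ 𝓕, 0 < mass (uu k ch (aa k)) I →
      avg (uu k ch b) I ≤ 14 * A ^ (1 - p) * τ I := by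
    intro I hI hm
    rw [avg, div_le_iff₀ (hlen I hI), ← hB]
    exact hσ I hI hm
  have aw0 : ∀ I ∈ 𝓕, 0 ≤ avg (uu k ch (aa k)) I := fun I hI =>
    div_nonneg (mass_nonneg nw I) (hlen I hI).le
  have as0 : ∀ I ∈ 𝓕, 0 ≤ avg (uu k ch b) I := fun I hI =>
    div_nonneg (mass_nonneg ns I) (hlen I hI).le
  constructor
  · apply sumTest_le hFS hS.2.1 hconv nw ns iw is (by linarith)
    · positivity
    intro F hF hLF
    have e1 : (14 * A) ^ p * (14 * A ^ (1 - p)) = 14 ^ (p + 1) * A := by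
      rw [Real.mul_rpow (by norm_num) hA0.le, Real.rpow_add (by norm_num), Real.rpow_one]
      have : A ^ p * A ^ (1 - p) = A := by
        rw [← Real.rpow_add hA0]; simp
      linear_combination (14 ^ p * 14 : ℝ) * this
    calc ∑ I ∈ F, avg (uu k ch (aa k)) I ^ p * avg (uu k ch b) I * len I
        ≤ ∑ I ∈ F, (14 ^ (p + 1) * A) * (τ I * len I) := by
          apply Finset.sum_le_sum
          intro I hI
          obtain ⟨g1, g2, g3⟩ := hF I hI
          have := hlen I g1
          have := hτ0 I g1
          calc _ ≤ (14 * A) ^ p * (14 * A ^ (1 - p) * τ I) * len I := by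
                gcongr
                · exact as0 I g1
                · exact aw0 I g1
                · exact avw I g1 g2
                · exact avs I g1 g2
            _ = ((14 * A) ^ p * (14 * A ^ (1 - p))) * (τ I * len I) := by ring
            _ = _ := by rw [e1]
      _ = (14 ^ (p + 1) * A) * ∑ I ∈ F, (τ I * len I) := by rw [Finset.mul_sum]
      _ ≤ (14 ^ (p + 1) * A) * (18 * k * (rr k * len K) / (1 - ε)) := by
          gcongr
          exact hsum F (fun I hI => (hF I hI).1) hLF
      _ = 18 * 14 ^ (p + 1) * k * (A * (rr k * len K)) / (1 - ε) := by ring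
      _ ≤ 18 * (14 ^ (p + 1) + 14 ^ (P + 1)) * k * (3 * (rr k * mass (uu k ch (aa k)) K)) /
            (1 - ε) := by
          gcongr
          linarith
      _ = _ := by ring
  · apply sumTest_le hFS hS.2.1 hconv ns nw is iw (by linarith)
    · positivity
    intro F hF hLF
    have e1 : (14 * A ^ (1 - p)) ^ P * (14 * A) = 14 ^ (P + 1) * A ^ (1 - p) := by
      rw [Real.mul_rpow (by norm_num) hB0.le, Real.rpow_add (by norm_num), Real.rpow_one,
        ← Real.rpow_mul hA0.le]
      have : A ^ ((1 - p) * P) * A = A ^ (1 - p) := by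
        nth_rewrite 2 [← Real.rpow_one A]
        rw [← Real.rpow_add hA0]
        congr 1
        rw [hP]; field_simp; ring
      linear_combination (14 ^ P * 14 : ℝ) * this
    calc ∑ I ∈ F, avg (uu k ch b) I ^ P * avg (uu k ch (aa k)) I * len I
        ≤ ∑ I ∈ F, (14 ^ (P + 1) * A ^ (1 - p)) * (τ I * len I) := by
          apply Finset.sum_le_sum
          intro I hI
          obtain ⟨g1, g3, g2⟩ := hF I hI
          have := hlen I g1
          have ht := hτ0 I g1
          have ht1 : τ I ^ P ≤ τ I := Real.rpow_le_self_of_le_one ht (hτ1 I g1) hP1.le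
          calc _ ≤ (14 * A ^ (1 - p) * τ I) ^ P * (14 * A) * len I := by
                gcongr
                · exact aw0 I g1
                · exact as0 I g1
                · exact avs I g1 g2
                · exact avw I g1 g2
            _ = ((14 * A ^ (1 - p)) ^ P * (14 * A)) * (τ I ^ P * len I) := by
                rw [Real.mul_rpow (by positivity) ht]; ring
            _ ≤ ((14 * A ^ (1 - p)) ^ P * (14 * A)) * (τ I * len I) := by gcongr
            _ = _ := by rw [e1]
      _ = (14 ^ (P + 1) * A ^ (1 - p)) * ∑ I ∈ F, (τ I * len I) := by rw [Finset.mul_sum]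
      _ ≤ (14 ^ (P + 1) * A ^ (1 - p)) * (18 * k * (rr k * len K) / (1 - ε)) := by
          gcongr
          exact hsum F (fun I hI => (hF I hI).1) hLF
      _ = 18 * 14 ^ (P + 1) * k * (A ^ (1 - p) * (rr k * len K)) / (1 - ε) := by ring
      _ ≤ 54 * (14 ^ (p + 1) + 14 ^ (P + 1)) * k * (mass (uu k ch b) K) /
            (1 - ε) := by
          gcongr
          · norm_num
          · linarith
      _ = _ := by ring

lemma S1_big {k : ℕ} (hk : 3000 < k) {ch : ℝ × ℝ → Bool} {c : ℝ} {i : ℕ} {K : ℝ × ℝ}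
    (h : K ∈ Kfam k i) {I : ℝ × ℝ} (hIK : ivSet I ⊆ ivSet K)
    (hdis : ivSet I ∩ ivSet (IJ k ch (mid K)) = ∅) (hch : ∀ K' ∈ chK k K, ¬ ivSet I ⊆ ivSet K')
    (hm : 0 < mass (uu k ch c) I) : rr k * len K ≤ 4 * len I := by
  have hK := len_pos h
  have hex : ∃ x ∈ ivSet I, uu k ch c x ≠ 0 := by
    by_contra hne
    push Not at hne
    rw [mass, setIntegral_eq_zero_of_forall_eq_zero hne] at hm
    exact lt_irrefl _ hm
  obtain ⟨x, hxI, hx⟩ := hex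
  have hG : ∃ n, x ∈ GG k ch n := by
    by_contra hne
    push Not at hne
    exact hx (uu_off hne)
  obtain ⟨n, hn⟩ := hG
  rcases G_cases hk h (hIK hxI) hn with ⟨-, h1⟩ | ⟨-, h1⟩
  · exact (Set.eq_empty_iff_forall_notMem.1 hdis x ⟨hxI, h1⟩).elim
  obtain ⟨j, hj, hxj⟩ := exists_child hk hK h1
  have hC : child k K j ∈ Kfam k (i + 1) := mem_succ.2 ⟨K, h, j, hj, rfl⟩
  have hnot := hch _ ⟨i, h, hC, (child_sub_mid hk hK hj).trans (mid_sub hK)⟩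
  obtain ⟨y, hyI, hy⟩ := Set.not_subset.1 hnot
  have hin : (child k K j).1 + len (child k K j) / 4 ≤ x ∧
      x ≤ (child k K j).2 - len (child k K j) / 4 := by
    rcases G_cases hk hC hxj hn with ⟨-, h2⟩ | ⟨-, h2⟩
    · exact IJ_in hk (len_pos hC) h2
    · exact mid_in (len_pos hC) h2
  rw [len_child] at hin
  rw [mem_iv] at hxI hyI hy
  rw [show len I = I.2 - I.1 from rfl]
  by_cases h3 : (child k K j).1 ≤ y
  · have : (child k K j).2 ≤ y := by
      by_contra h4
      exact hy ⟨h3, not_le.1 h4⟩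
    linarith
  · push Not at h3
    linarith

/-- Proposition 4.9 (a) of the paper: testing sums over the families `𝒮¹_K`, `𝒮²_K`, `𝒮³_K`
are bounded by `C(p)·k·3^{-k}·w_k(K)/(1-ε)` and `C(p)·k·σ_k(K)/(1-ε)`. -/
theorem statement10 (p : ℝ) (hp : 1 < p) :
    ∃ C : ℝ, 0 < C ∧ ∀ k : ℕ, 3000 < k → ∀ ch : ℝ × ℝ → Bool,
      ∀ ε : ℝ, 0 < ε → ε < 1 → ∀ S : Set (ℝ × ℝ), MSparse ε S →
      (∀ I ∈ S, ivSet I ⊆ Set.Ico (0 : ℝ) 1) →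
      ∀ K ∈ KK k,
        ((sumTest p (wgt k ch) (sgm p k ch)
              {I | I ∈ S ∧ ivSet I ⊆ ivSet K ∧ ivSet I ∩ ivSet (IJ k ch (mid K)) = ∅ ∧
                ∀ K' ∈ chK k K, ¬ ivSet I ⊆ ivSet K'} ≤
            C * ((k : ℝ) * (3 : ℝ) ^ (-(k : ℤ)) * mass (wgt k ch) K) / (1 - ε) ∧
          sumTest (p / (p - 1)) (sgm p k ch) (wgt k ch)
              {I | I ∈ S ∧ ivSet I ⊆ ivSet K ∧ ivSet I ∩ ivSet (IJ k ch (mid K)) = ∅ ∧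
                ∀ K' ∈ chK k K, ¬ ivSet I ⊆ ivSet K'} ≤
            C * ((k : ℝ) * mass (sgm p k ch) K) / (1 - ε)) ∧
         (sumTest p (wgt k ch) (sgm p k ch)
              {I | I ∈ S ∧ ivSet I ⊆ ivSet K ∧
                (ivSet I ∩ ivSet (IJ k ch (mid K))).Nonempty ∧
                ivSet I ∩ ivSet (mid K) = ∅} ≤
            C * ((k : ℝ) * (3 : ℝ) ^ (-(k : ℤ)) * mass (wgt k ch) K) / (1 - ε) ∧
          sumTest (p / (p - 1)) (sgm p k ch) (wgt k ch)
              {I | I ∈ S ∧ ivSet I ⊆ ivSet K ∧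
                (ivSet I ∩ ivSet (IJ k ch (mid K))).Nonempty ∧
                ivSet I ∩ ivSet (mid K) = ∅} ≤
            C * ((k : ℝ) * mass (sgm p k ch) K) / (1 - ε)) ∧
         (sumTest p (wgt k ch) (sgm p k ch)
              {I | I ∈ S ∧ ivSet I ⊆ ivSet K ∧ (ivSet I ∩ ivSet (mid K)).Nonempty ∧
                (ivSet I ∩ ivSet (IJ k ch (mid K))).Nonempty ∧
                2 * len (IJ k ch (mid K)) ≤ len I} ≤
            C * ((k : ℝ) * (3 : ℝ) ^ (-(k : ℤ)) * mass (wgt k ch) K) / (1 - ε) ∧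
          sumTest (p / (p - 1)) (sgm p k ch) (wgt k ch)
              {I | I ∈ S ∧ ivSet I ⊆ ivSet K ∧ (ivSet I ∩ ivSet (mid K)).Nonempty ∧
                (ivSet I ∩ ivSet (IJ k ch (mid K))).Nonempty ∧
                2 * len (IJ k ch (mid K)) ≤ len I} ≤
            C * ((k : ℝ) * mass (sgm p k ch) K) / (1 - ε))) := by
  have hp1 : 0 < p - 1 := by linarith
  refine ⟨54 * (14 ^ (p + 1) + 14 ^ (p / (p - 1) + 1)), by positivity, ?_⟩
  intro k hk ch ε hε0 hε1 S hS hS01 K hKK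
  obtain ⟨i, h⟩ := mem_iUnion.1 hKK
  have hε' : 0 < 1 - ε := by linarith
  have hK := len_pos h
  have ha := aa_pos k
  have ha1 := aa_ge hk
  have ha3 := aa_lt hk
  have hb : 0 < aa k ^ (1 - p) := Real.rpow_pos_of_pos ha _
  have hb1 : aa k ^ (1 - p) ≤ 1 := Real.rpow_le_one_of_one_le_of_nonpos ha1 (by linarith)
  have hr := rr_pos k
  have hr27 := rr_le hk
  have hl : 0 < rr k * len K := mul_pos hr hK
  have hlL := len_IJ k ch K
  have hkl : 3 ^ k * (rr k * len K) = len K := by rw [← mul_assoc, pow_rr, one_mul]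
  have hpos : ∀ I ∈ S, 0 < len I := fun I hI => by
    have := hS.2.1 I hI; rw [len]; linarith
  have hk1 : (1 : ℝ) ≤ k := by exact_mod_cast (by omega : 1 ≤ k)
  have hA0 : 0 < aa k ^ (i + 1) := by positivity
  have hB0 : 0 < (aa k ^ (1 - p)) ^ (i + 1) := by positivity
  refine ⟨?_, ?_, ?_⟩
  · apply final hp hk hε1 hS h (fun I hI => hI.1) (fun I hI => hI.2.1) ?_ (fun _ => rr k)
      (fun _ _ => hr.le) (fun _ _ => by linarith)
    · intro I hI hm
      have hI0 := hpos I hI.1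
      have hbig := S1_big hk h hI.2.1 hI.2.2.1 hI.2.2.2 hm
      have h1 := mass_split (ch := ch) hk ha ha3 h hI.2.1
      have h2 := mass_w_mid (ch := ch) hk h (hS.2.1 I hI.1)
      rw [hI.2.2.1, measureReal_empty, mul_zero, zero_add] at h1
      have h3 : aa k ^ (i + 1) * (len I + 2 * (rr k * len K)) ≤ aa k ^ (i + 1) * (14 * len I) := by
        gcongr; linarith
      linarith
    · intro I hI hm
      have hI0 := hpos I hI.1
      have hbig := S1_big hk h hI.2.1 hI.2.2.1 hI.2.2.2 hm
      have h1 := mass_split (ch := ch) hk hb (by linarith) h hI.2.1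
      have h2 := mass_s_mid (ch := ch) hk hb hb1 h (hS.2.1 I hI.1)
      rw [hI.2.2.1, measureReal_empty, mul_zero, zero_add] at h1
      have h3 : (aa k ^ (1 - p)) ^ (i + 1) * (3 / 2 * rr k * (len I + 2 * (rr k * len K))) ≤
          (aa k ^ (1 - p)) ^ (i + 1) * (3 / 2 * rr k * (9 * len I)) := by
        gcongr; linarith
      have h4 : 0 < (aa k ^ (1 - p)) ^ (i + 1) * rr k * len I := by positivity
      linarith
    · intro F hF hLF
      have h1 := carleson hε1 hS (fun I hI => (hF I hI).1) hLF (A := K.1) (B := K.2)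
        (by rw [len] at hK; linarith) (fun I hI => (hF I hI).2.1)
      rw [← Finset.mul_sum]
      calc _ ≤ rr k * ((K.2 - K.1) / (1 - ε)) := by gcongr
        _ = 1 * (rr k * len K) / (1 - ε) := by rw [len]; ring
        _ ≤ _ := by gcongr; linarith
    · intro I hI I' hI' Q hQ h1 h2
      refine ⟨hQ, h2.trans hI'.2.1, ?_, fun K' hK' hh => hI.2.2.2 K' hK' (h1.trans hh)⟩
      exact subset_empty_iff.1 ((inter_subset_inter_left _ h2).trans hI'.2.2.1.le)
  · apply final hp hk hε1 hS h (fun I hI => hI.1) (fun I hI => hI.2.1) ?_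
      (fun I => min (len I) (rr k * len K) / len I)
      (fun I hI => div_nonneg (le_min (hpos I hI.1).le hl.le) (hpos I hI.1).le)
      (fun I hI => (div_le_one (hpos I hI.1)).2 (min_le_left _ _))
    · intro I hI hm
      have hI0 := hpos I hI.1
      have h1 := mass_split (ch := ch) hk ha ha3 h hI.2.1
      rw [hI.2.2.2, setIntegral_empty, add_zero] at h1
      have h2 := (vol_inter_le hI0.le (by rw [hlL]; exact hl.le)).trans (min_le_left _ _)
      have h3 := mul_le_mul_of_nonneg_left h2 hA0.le
      have h4 := mul_pos hA0 hI0
      linarith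
    · intro I hI hm
      have hI0 := hpos I hI.1
      have h1 := mass_split (ch := ch) hk hb (by linarith) h hI.2.1
      rw [hI.2.2.2, setIntegral_empty, add_zero] at h1
      have h2 := vol_inter_le (L := IJ k ch (mid K)) hI0.le (by rw [hlL]; exact hl.le)
      rw [hlL] at h2
      have h3 := mul_le_mul_of_nonneg_left h2 hB0.le
      rw [mul_assoc _ _ (len I), div_mul_cancel₀ _ hI0.ne']
      have h4 : 0 ≤ (aa k ^ (1 - p)) ^ (i + 1) * min (len I) (rr k * len K) := by
        have := le_min hI0.le hl.le
        positivity
      linarith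
    · intro F hF hLF
      have h1 := tau_sum hε1 hS (fun I hI => (hF I hI).1) hLF (L := IJ k ch (mid K))
        (by rw [hlL]; exact hl) (k := k) (by omega) (fun I hI => (hF I hI).2.2.1)
        (fun I hI => by
          rw [hlL, hkl]; exact iv_len_le (hS.2.1 I (hF I hI).1) (hF I hI).2.1)
      rw [hlL] at h1
      rwa [Finset.sum_congr rfl (fun I hI => div_mul_cancel₀ _ (hpos I (hF I hI).1).ne')]
    · intro I hI I' hI' Q hQ h1 h2
      refine ⟨hQ, h2.trans hI'.2.1, hI.2.2.1.mono (inter_subset_inter_left _ h1), ?_⟩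
      exact subset_empty_iff.1 ((inter_subset_inter_left _ h2).trans hI'.2.2.2.le)
  · apply final hp hk hε1 hS h (fun I hI => hI.1) (fun I hI => hI.2.1) ?_
      (fun I => min (len I) (rr k * len K) / len I)
      (fun I hI => div_nonneg (le_min (hpos I hI.1).le hl.le) (hpos I hI.1).le)
      (fun I hI => (div_le_one (hpos I hI.1)).2 (min_le_left _ _))
    · intro I hI hm
      have hI0 := hpos I hI.1
      have hbig := hI.2.2.2.2
      rw [hlL] at hbig
      have h1 := mass_split (ch := ch) hk ha ha3 h hI.2.1
      have h5 := mass_w_mid (ch := ch) hk h (hS.2.1 I hI.1)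
      have h2 := (vol_inter_le hI0.le (by rw [hlL]; exact hl.le)).trans (min_le_left _ _)
      have h3 := mul_le_mul_of_nonneg_left h2 hA0.le
      have h6 := mul_le_mul_of_nonneg_left hbig hA0.le
      have h4 := mul_pos hA0 hI0
      linarith
    · intro I hI hm
      have hI0 := hpos I hI.1
      have hbig := hI.2.2.2.2
      rw [hlL] at hbig
      have h1 := mass_split (ch := ch) hk hb (by linarith) h hI.2.1
      have h5 := mass_s_mid (ch := ch) hk hb hb1 h (hS.2.1 I hI.1)
      have h2 := (vol_inter_le (L := IJ k ch (mid K)) hI0.le (by rw [hlL]; exact hl.le)).trans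
        (min_le_right _ _)
      rw [hlL] at h2
      have h3 := mul_le_mul_of_nonneg_left h2 hB0.le
      rw [mul_assoc _ _ (len I), div_mul_cancel₀ _ hI0.ne', min_eq_right (by linarith)]
      have h7 := iv_len_le (hS.2.1 I hI.1) hI.2.1
      have h6 : (aa k ^ (1 - p)) ^ (i + 1) * (3 / 2 * rr k * (len I + 2 * (rr k * len K))) ≤
          (aa k ^ (1 - p)) ^ (i + 1) * (3 / 2 * rr k * (2 * len K)) := by
        gcongr; linarith
      have h4 := mul_pos hB0 hl
      linarith
    · intro F hF hLF
      have h1 := tau_sum hε1 hS (fun I hI => (hF I hI).1) hLF (L := IJ k ch (mid K))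
        (by rw [hlL]; exact hl) (k := k) (by omega) (fun I hI => (hF I hI).2.2.2.1)
        (fun I hI => by
          rw [hlL, hkl]; exact iv_len_le (hS.2.1 I (hF I hI).1) (hF I hI).2.1)
      rw [hlL] at h1
      rwa [Finset.sum_congr rfl (fun I hI => div_mul_cancel₀ _ (hpos I (hF I hI).1).ne')]
    · intro I hI I' hI' Q hQ h1 h2
      refine ⟨hQ, h2.trans hI'.2.1, hI.2.2.1.mono (inter_subset_inter_left _ h1),
        hI.2.2.2.1.mono (inter_subset_inter_left _ h1), ?_⟩
      exact hI.2.2.2.2.trans (iv_len_le (hS.2.1 I hI.1) h1)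

end RTpaper
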